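/- Consider Model (A): X and ε are independent real-valued random variables, X ~ N(μ0, σ0²), ε ~ N(0, ω²) with σ0, ω > 0, and Y = X + ε. Let μ ∈ ℝ, σ > 0, and let c0(x) = x + 2σ·[φ((x−μ)/σ) − ((x−μ)/σ)·(1 − Φ((x−μ)/σ))] − (μ + σ/√π) be the CRPS of the Gaussian forecast N(μ, σ²). Then, almost surely, E[c0(X) | σ(Y)] = Ȳ + 2·σ_ω·[φ((Ȳ − μ)/σ_ω) − ((Ȳ − μ)/σ_ω)·(1 − Φ((Ȳ − μ)/σ_ω))] − (μ + σ/√π), where Ȳ = (ω²·μ0 + σ0²·Y)/(σ0² + ω²) and σ_ω² = σ² + ω²σ0²/(σ0² + ω²). -/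

import Mathlib

open MeasureTheory ProbabilityTheory Real

/-- The probability density function of the standard normal distribution. -/
noncomputable def stdNormalPDF (z : ℝ) : ℝ := (Real.sqrt (2 * π))⁻¹ * Real.exp (-z ^ 2 / 2)

/-- The cumulative distribution function of the standard normal distribution. -/
noncomputable def stdNormalCDF (z : ℝ) : ℝ := ∫ t in Set.Iic z, stdNormalPDF t

lemma stdNormalPDF_eq_gaussianPDFReal : stdNormalPDF = gaussianPDFReal 0 1 := by
  ext z
  simp [stdNormalPDF, gaussianPDFReal]

lemma integrable_stdNormalPDF : Integrable stdNormalPDF :=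
  stdNormalPDF_eq_gaussianPDFReal ▸ integrable_gaussianPDFReal 0 1

lemma hasDerivAt_stdNormalPDF (z : ℝ) : HasDerivAt stdNormalPDF (-(z * stdNormalPDF z)) z := by
  have h : HasDerivAt (fun z : ℝ => -z ^ 2 / 2) (-z) z := by
    refine ((hasDerivAt_pow 2 z).fun_neg.div_const 2).congr_deriv ?_
    push_cast
    ring
  refine (h.exp.const_mul (√(2 * π))⁻¹).congr_deriv ?_
  rw [stdNormalPDF]
  ring

lemma tendsto_stdNormalPDF_atTop : Filter.Tendsto stdNormalPDF Filter.atTop (nhds 0) := by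
  have h : Filter.Tendsto (fun z : ℝ => -z ^ 2 / 2) Filter.atTop Filter.atBot := by
    simp_rw [neg_div]
    exact Filter.tendsto_neg_atTop_atBot.comp
      ((Filter.tendsto_pow_atTop two_ne_zero).atTop_div_const two_pos)
  rw [← mul_zero (√(2 * π))⁻¹]
  exact (Real.tendsto_exp_atBot.comp h).const_mul _

lemma integrable_mul_stdNormalPDF : Integrable fun z : ℝ => z * stdNormalPDF z := by
  convert (integrable_mul_exp_neg_mul_sq (b := 2⁻¹) (by norm_num)).const_mul (√(2 * π))⁻¹ using 2
    with z
  rw [stdNormalPDF, show -z ^ 2 / 2 = -2⁻¹ * z ^ 2 by ring]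
  ring

lemma setIntegral_Ioi_mul_stdNormalPDF (z : ℝ) :
    ∫ t in Set.Ioi z, t * stdNormalPDF t = stdNormalPDF z := by
  have h := integral_Ioi_of_hasDerivAt_of_tendsto' (a := z)
    (fun t _ => (hasDerivAt_stdNormalPDF t).fun_neg) (m := 0)
    (by simpa using integrable_mul_stdNormalPDF.integrableOn)
    (by simpa using tendsto_stdNormalPDF_atTop.neg)
  simpa using h

lemma setIntegral_Ioi_stdNormalPDF (z : ℝ) :
    ∫ t in Set.Ioi z, stdNormalPDF t = 1 - stdNormalCDF z := by
  have h := integral_add_compl (measurableSet_Iic (a := z)) integrable_stdNormalPDF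
  have h1 : ∫ t, stdNormalPDF t = 1 := by
    rw [stdNormalPDF_eq_gaussianPDFReal]
    exact integral_gaussianPDFReal_eq_one 0 one_ne_zero
  rw [Set.compl_Iic, h1] at h
  rw [stdNormalCDF]
  linarith

/-- The expected positive part of `Z - z` for a standard normal `Z`. -/
lemma integral_max_sub_stdGaussian (z : ℝ) :
    ∫ t, max (t - z) 0 ∂gaussianReal 0 1 = stdNormalPDF z - z * (1 - stdNormalCDF z) := by
  have hmax (t : ℝ) : stdNormalPDF t * max (t - z) 0
      = (Set.Ioi z).indicator (fun t => t * stdNormalPDF t - z * stdNormalPDF t) t := by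
    by_cases ht : z < t
    · rw [Set.indicator_of_mem (Set.mem_Ioi.2 ht), max_eq_left (by linarith)]
      ring
    · rw [Set.indicator_of_notMem (by simpa using ht), max_eq_right (by linarith), mul_zero]
  rw [integral_gaussianReal_eq_integral_smul one_ne_zero, ← stdNormalPDF_eq_gaussianPDFReal]
  simp_rw [smul_eq_mul, hmax]
  rw [integral_indicator measurableSet_Ioi,
    integral_sub integrable_mul_stdNormalPDF.integrableOn
      (integrable_stdNormalPDF.const_mul z).integrableOn,
    integral_const_mul, setIntegral_Ioi_mul_stdNormalPDF, setIntegral_Ioi_stdNormalPDF]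

/-- The expected positive part of `T - x` for `T ∼ N(m, σ²)`. -/
lemma integral_max_sub_gaussianReal (m x : ℝ) {σ : ℝ} (hσ : 0 < σ) :
    ∫ t, max (t - x) 0 ∂gaussianReal m ⟨σ ^ 2, sq_nonneg σ⟩
      = σ * (stdNormalPDF ((x - m) / σ) - (x - m) / σ * (1 - stdNormalCDF ((x - m) / σ))) := by
  have hlaw : (gaussianReal 0 1).map (fun z => σ * z + m)
      = gaussianReal m ⟨σ ^ 2, sq_nonneg σ⟩ := by
    rw [show (fun z => σ * z + m) = (fun z => z + m) ∘ (fun z => σ * z) from rfl,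
      ← Measure.map_map (by fun_prop) (by fun_prop), gaussianReal_map_const_mul,
      gaussianReal_map_add_const, mul_zero, zero_add, mul_one]
    rfl
  rw [← hlaw, integral_map (by fun_prop) (by fun_prop), ← integral_max_sub_stdGaussian,
    ← integral_const_mul]
  congr 1 with z
  rw [mul_max_of_nonneg _ _ hσ.le, mul_zero, mul_sub, mul_div_cancel₀ _ hσ.ne']
  congr 1
  ring

lemma integrable_max_sub_gaussianReal_prod (m₁ m₂ : ℝ) (v₁ v₂ : NNReal) :
    Integrable (fun p : ℝ × ℝ => max (p.2 - p.1) 0)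
      ((gaussianReal m₁ v₁).prod (gaussianReal m₂ v₂)) := by
  have h (m : ℝ) (v : NNReal) : Integrable (fun x : ℝ => x) (gaussianReal m v) :=
    (memLp_id_gaussianReal 1).integrable le_rfl
  exact (((h m₂ v₂).comp_snd _).sub ((h m₁ v₁).comp_fst _)).pos_part

/-- Averaging the expected positive part of `T - x`, `T ∼ N(m₂, v₂)`, over `x ∼ N(m₁, v₁)` adds
the variances. -/
lemma integral_integral_max_sub_gaussianReal (m₁ m₂ : ℝ) (v₁ v₂ : NNReal) :
    ∫ x, ∫ t, max (t - x) 0 ∂gaussianReal m₂ v₂ ∂gaussianReal m₁ v₁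
      = ∫ t, max (t - m₁) 0 ∂gaussianReal m₂ (v₂ + v₁) := by
  have hlaw : ((gaussianReal m₁ v₁).prod (gaussianReal m₂ v₂)).map
      ((fun p : ℝ × ℝ => p.2) + fun p => -p.1) = gaussianReal (m₂ + -m₁) (v₂ + v₁) := by
    refine gaussianReal_add_gaussianReal_of_indepFun
      (indepFun_prod (X := fun x : ℝ => -x) (Y := fun x : ℝ => x)
        (by fun_prop) (by fun_prop)).symm ?_ ?_
    · exact measurePreserving_snd.map_eq
    · rw [show (fun p : ℝ × ℝ => -p.1) = (fun x => -x) ∘ Prod.fst from rfl,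
        ← Measure.map_map (by fun_prop) (by fun_prop), measurePreserving_fst.map_eq,
        gaussianReal_map_neg]
  rw [← integral_prod (fun p : ℝ × ℝ => max (p.2 - p.1) 0)
    (integrable_max_sub_gaussianReal_prod m₁ m₂ v₁ v₂)]
  trans ∫ u, max u 0 ∂gaussianReal (m₂ + -m₁) (v₂ + v₁)
  · rw [← hlaw, integral_map (by fun_prop) (by fun_prop)]
    simp [sub_eq_add_neg]
  · rw [← gaussianReal_map_add_const, integral_map (by fun_prop) (by fun_prop)]
    simp [sub_eq_add_neg]

/-- If `W` is independent of `Y`, then conditioning `f (Y, W)` on `Y` integrates out `W`. -/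
lemma condExp_ae_eq_integral_of_indepFun {Ω : Type*} [MeasurableSpace Ω] {P : Measure Ω}
    [IsProbabilityMeasure P] {Y W : Ω → ℝ} (hY : Measurable Y) (hW : Measurable W)
    (hYW : IndepFun Y W P) {f : ℝ × ℝ → ℝ} (hf : StronglyMeasurable f)
    (hint : Integrable (fun a => f (Y a, W a)) P) :
    P[(fun a => f (Y a, W a)) | MeasurableSpace.comap Y inferInstance]
      =ᵐ[P] fun a => ∫ w, f (Y a, w) ∂P.map W := by
  have := Measure.isProbabilityMeasure_map hW.aemeasurable (μ := P)
  have hcond : condDistrib W Y P =ᵐ[P.map Y] Kernel.const ℝ (P.map W) := by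
    refine (condDistrib_ae_eq_iff_measure_eq_compProd Y hW.aemeasurable _).2 ?_
    rw [Measure.compProd_const,
      (indepFun_iff_map_prod_eq_prod_map_map hY.aemeasurable hW.aemeasurable).1 hYW]
  filter_upwards [condExp_prod_ae_eq_integral_condDistrib hY hW.aemeasurable hf hint,
    ae_of_ae_map hY.aemeasurable hcond] with a h h'
  rw [h, h', Kernel.const_apply]

/-- The posterior of a Gaussian `X` observed through independent centred Gaussian noise `ε`. -/
lemma condExp_comp_gaussian_add_noise {Ω : Type*} [MeasurableSpace Ω] {P : Measure Ω}
    [IsProbabilityMeasure P] {X ε : Ω → ℝ} (hX : Measurable X) (hε : Measurable ε)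
    {m : ℝ} {σ ω : ℝ} (hσ : 0 < σ)
    (hXlaw : P.map X = gaussianReal m ⟨σ ^ 2, sq_nonneg σ⟩)
    (hεlaw : P.map ε = gaussianReal 0 ⟨ω ^ 2, sq_nonneg ω⟩)
    (hindep : IndepFun X ε P) {f : ℝ → ℝ} (hf : StronglyMeasurable f)
    (hint : Integrable f (P.map X)) {v : NNReal}
    (hv : (v : ℝ) = ω ^ 2 * σ ^ 2 / (σ ^ 2 + ω ^ 2)) :
    P[(fun a => f (X a)) | MeasurableSpace.comap (fun a => X a + ε a) inferInstance]
      =ᵐ[P] fun a => ∫ x, f x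
        ∂gaussianReal ((ω ^ 2 * m + σ ^ 2 * (X a + ε a)) / (σ ^ 2 + ω ^ 2)) v := by
  have hS : σ ^ 2 + ω ^ 2 ≠ 0 := by positivity
  set S := σ ^ 2 + ω ^ 2 with hS_def
  set W : Ω → ℝ := fun a => ω ^ 2 / S * X a + -(σ ^ 2 / S) * ε a with hW
  have hXg : HasGaussianLaw X P := ⟨hXlaw ▸ isGaussian_gaussianReal _ _⟩
  have hεg : HasGaussianLaw ε P := ⟨hεlaw ▸ isGaussian_gaussianReal _ _⟩
  have hjoint : HasGaussianLaw (fun a => (X a + ε a, W a)) P := by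
    let L : ℝ × ℝ →L[ℝ] ℝ × ℝ :=
      (ContinuousLinearMap.fst ℝ ℝ ℝ + ContinuousLinearMap.snd ℝ ℝ ℝ).prod
        ((ω ^ 2 / S) • ContinuousLinearMap.fst ℝ ℝ ℝ
          + (-(σ ^ 2 / S)) • ContinuousLinearMap.snd ℝ ℝ ℝ)
    exact (hindep.hasGaussianLaw hXg hεg).map_fun L
  have hvarX : Var[X; P] = σ ^ 2 := by
    have := variance_id_gaussianReal (μ := m) (v := ⟨σ ^ 2, sq_nonneg σ⟩)
    rwa [← hXlaw, variance_id_map hX.aemeasurable] at this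
  have hvarε : Var[ε; P] = ω ^ 2 := by
    have := variance_id_gaussianReal (μ := 0) (v := ⟨ω ^ 2, sq_nonneg ω⟩)
    rwa [← hεlaw, variance_id_map hε.aemeasurable] at this
  have hX2 := hXg.memLp_two
  have hε2 := hεg.memLp_two
  have hcov : cov[fun a => X a + ε a, W; P] = 0 := by
    change cov[X + ε, (fun a => ω ^ 2 / S * X a) + fun a => -(σ ^ 2 / S) * ε a; P] = 0
    have hXε := hindep.covariance_eq_zero hX2 hε2
    have hεX := hindep.symm.covariance_eq_zero hε2 hX2
    rw [covariance_add_left hX2 hε2 ((hX2.const_mul _).add (hε2.const_mul _)),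
      covariance_add_right hX2 (hX2.const_mul _) (hε2.const_mul _),
      covariance_add_right hε2 (hX2.const_mul _) (hε2.const_mul _)]
    simp only [covariance_const_mul_right, hXε, hεX, covariance_self hX.aemeasurable,
      covariance_self hε.aemeasurable, hvarX, hvarε]
    ring
  have hYW := hjoint.indepFun_of_covariance_eq_zero hcov
  have hWlaw : P.map W = gaussianReal (ω ^ 2 / S * m) v := by
    have hmul {Z : Ω → ℝ} {n : ℝ} {w : NNReal} (hZ : Measurable Z)
        (hZlaw : P.map Z = gaussianReal n w) (c : ℝ) :
        P.map (fun a => c * Z a) = gaussianReal (c * n) (.mk (c ^ 2) (sq_nonneg c) * w) := by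
      rw [← gaussianReal_map_const_mul, ← hZlaw, Measure.map_map (by fun_prop) hZ]
      rfl
    have hadd := gaussianReal_add_gaussianReal_of_indepFun
      (hindep.comp (φ := fun x => ω ^ 2 / S * x) (ψ := fun x => -(σ ^ 2 / S) * x)
        (by fun_prop) (by fun_prop)) (hmul hX hXlaw _) (hmul hε hεlaw _)
    refine hadd.trans ?_
    congr 1
    · ring
    · ext
      change (ω ^ 2 / S) ^ 2 * σ ^ 2 + (-(σ ^ 2 / S)) ^ 2 * ω ^ 2 = v
      rw [hv]
      field_simp
      rw [hS_def]
      ring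
  have hdecomp (a : Ω) : X a = σ ^ 2 / S * (X a + ε a) + W a := by
    simp only [hW]
    field_simp
    ring
  have hcond := condExp_ae_eq_integral_of_indepFun (f := fun p => f (σ ^ 2 / S * p.1 + p.2))
    (hX.add hε) (by fun_prop : Measurable W) hYW (hf.comp_measurable (by fun_prop))
    (by
      simp only [Pi.add_apply, ← hdecomp]
      exact hint.comp_measurable hX)
  simp only [Pi.add_apply, ← hdecomp] at hcond
  refine hcond.trans (ae_of_all _ fun a => ?_)
  dsimp only
  rw [hWlaw, show (ω ^ 2 * m + σ ^ 2 * (X a + ε a)) / S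
      = ω ^ 2 / S * m + σ ^ 2 / S * (X a + ε a) by ring,
    ← gaussianReal_map_const_add, integral_map (by fun_prop) hf.aestronglyMeasurable]

/-- Proposition 3: under Model (A), the conditional expectation of the Gaussian CRPS
`c0(X)` given `σ(Y)` is the corrected CRPS `c∨(f, Ȳ)` evaluated at
`Ȳ = (ω²μ0 + σ0²Y)/(σ0² + ω²)` with scale `σ_ω² = σ² + ω²σ0²/(σ0² + ω²)`. -/
theorem stmt10 {Ω : Type*} [MeasurableSpace Ω] (P : Measure Ω) [IsProbabilityMeasure P]
    (X ε : Ω → ℝ) (hX : Measurable X) (hε : Measurable ε)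
    (μ0 σ0 ω : ℝ) (hσ0 : 0 < σ0) (hω : 0 < ω)
    (hXlaw : P.map X = gaussianReal μ0 ⟨σ0 ^ 2, sq_nonneg σ0⟩)
    (hεlaw : P.map ε = gaussianReal 0 ⟨ω ^ 2, sq_nonneg ω⟩)
    (hindep : IndepFun X ε P)
    (Y : Ω → ℝ) (hY : Y = fun ω' => X ω' + ε ω')
    (μ σ : ℝ) (hσ : 0 < σ)
    (c0 : ℝ → ℝ)
    (hc0 : c0 = fun x => x + 2 * σ * (stdNormalPDF ((x - μ) / σ)
        - ((x - μ) / σ) * (1 - stdNormalCDF ((x - μ) / σ))) - (μ + σ / Real.sqrt π))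
    (σω : ℝ) (hσω : σω = Real.sqrt (σ ^ 2 + ω ^ 2 * σ0 ^ 2 / (σ0 ^ 2 + ω ^ 2)))
    (Ybar : Ω → ℝ) (hYbar : Ybar = fun ω' => (ω ^ 2 * μ0 + σ0 ^ 2 * Y ω') / (σ0 ^ 2 + ω ^ 2)) :
    P[(fun ω' => c0 (X ω')) | MeasurableSpace.comap Y inferInstance]
      =ᵐ[P] fun ω' => Ybar ω'
        + 2 * σω * (stdNormalPDF ((Ybar ω' - μ) / σω)
            - ((Ybar ω' - μ) / σω) * (1 - stdNormalCDF ((Ybar ω' - μ) / σω)))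
        - (μ + σ / Real.sqrt π) := by
  subst hY hYbar
  set s : NNReal := ⟨σ ^ 2, sq_nonneg σ⟩
  obtain ⟨v, hv⟩ : ∃ v : NNReal, (v : ℝ) = ω ^ 2 * σ0 ^ 2 / (σ0 ^ 2 + ω ^ 2) :=
    ⟨⟨_, by positivity⟩, rfl⟩
  have hσω_pos : 0 < σω := by rw [hσω]; positivity
  have hsv : s + v = ⟨σω ^ 2, sq_nonneg σω⟩ := by
    ext
    change σ ^ 2 + (v : ℝ) = σω ^ 2
    rw [hv, hσω, Real.sq_sqrt (by positivity)]
  have hc0' : c0 = fun x => x + 2 * ∫ t, max (t - x) 0 ∂gaussianReal μ s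
      - (μ + σ / √π) := by
    ext x
    rw [hc0, integral_max_sub_gaussianReal μ x hσ]
    ring
  have hid (m : ℝ) (w : NNReal) : Integrable (fun x : ℝ => x) (gaussianReal m w) :=
    (memLp_id_gaussianReal 1).integrable le_rfl
  have hpos (m : ℝ) (w : NNReal) :
      Integrable (fun x => 2 * ∫ t, max (t - x) 0 ∂gaussianReal μ s) (gaussianReal m w) :=
    (integrable_max_sub_gaussianReal_prod m μ w s).integral_prod_left.const_mul 2
  have hc0_int (m : ℝ) (w : NNReal) : Integrable c0 (gaussianReal m w) := by
    rw [hc0']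
    exact ((hid m w).add (hpos m w)).sub (integrable_const _)
  have hc0_meas : StronglyMeasurable c0 := by
    rw [hc0']
    refine (stronglyMeasurable_id.add (StronglyMeasurable.const_mul ?_ 2)).sub
      stronglyMeasurable_const
    exact StronglyMeasurable.integral_prod_right' (f := fun p : ℝ × ℝ => max (p.2 - p.1) 0)
      (by fun_prop)
  refine (condExp_comp_gaussian_add_noise hX hε hσ0 hXlaw hεlaw hindep hc0_meas
    (hXlaw ▸ hc0_int _ _) hv).trans (ae_of_all _ fun a => ?_)
  dsimp only
  generalize (ω ^ 2 * μ0 + σ0 ^ 2 * (X a + ε a)) / (σ0 ^ 2 + ω ^ 2) = y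
  simp only [hc0']
  rw [integral_sub (by exact (hid y v).add (hpos y v)) (integrable_const _),
    integral_add (hid y v) (hpos y v), integral_const_mul,
    integral_integral_max_sub_gaussianReal, hsv, integral_max_sub_gaussianReal μ y hσω_pos,
    integral_id_gaussianReal]
  simp only [integral_const, probReal_univ, one_smul]
  ring
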